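/- arXiv:1905.09031 — 3 statements merged into one kernel-verified Lean document; each statement's English description precedes it below -/
import Mathlib

section
/- Every unital vector-lattice homomorphism on U is an evaluation: if φ : U → ℝ is a homomorphism with φ(𝟏) = 1, then there exists t ∈ ℍ such that φ(f) = f(t) for every f ∈ U. -/
open Filter Topology

/-- `Hl` is the half-line `[1, ∞)` with the metric inherited from `ℝ`. -/
abbrev Hl : Type := Set.Ici (1 : ℝ)

/-- `φ` is a vector-lattice homomorphism on the lattice `U` of uniformly continuous
real-valued functions on the half-line: it is additive, homogeneous and preserves
binary suprema on uniformly continuous functions.  (The value of `φ` outside `U` is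
irrelevant: all hypotheses and conclusions only involve uniformly continuous
functions.) -/
def IsLatticeHom (φ : (Hl → ℝ) → ℝ) : Prop :=
  (∀ f g : Hl → ℝ, UniformContinuous f → UniformContinuous g →
      φ (f + g) = φ f + φ g) ∧
  (∀ (c : ℝ) (f : Hl → ℝ), UniformContinuous f → φ (c • f) = c * φ f) ∧
  (∀ f g : Hl → ℝ, UniformContinuous f → UniformContinuous g →
      φ (f ⊔ g) = max (φ f) (φ g))

namespace IsLatticeHom

variable {φ : (Hl → ℝ) → ℝ} {f g : Hl → ℝ}

theorem map_mono (hφ : IsLatticeHom φ) (hf : UniformContinuous f) (hg : UniformContinuous g)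
    (hfg : f ≤ g) : φ f ≤ φ g := by
  have h := hφ.2.2 f g hf hg
  rw [sup_eq_right.mpr hfg] at h
  exact h ▸ le_max_left _ _

theorem map_abs_sub_const (hφ : IsLatticeHom φ) (h1 : φ (fun _ => (1 : ℝ)) = 1)
    (hf : UniformContinuous f) (c : ℝ) : φ (fun x => |f x - c|) = |φ f - c| := by
  obtain ⟨hadd, hsmul, hsup⟩ := hφ
  have hone : UniformContinuous (fun _ : Hl => (1 : ℝ)) := uniformContinuous_const
  have hc : UniformContinuous ((-c) • fun _ : Hl => (1 : ℝ)) := hone.const_smul (-c)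
  have hsub : UniformContinuous (f + (-c) • fun _ : Hl => (1 : ℝ)) := hf.add hc
  have habs : (fun x => |f x - c|) = (f + (-c) • fun _ : Hl => (1 : ℝ)) ⊔
      (-1 : ℝ) • (f + (-c) • fun _ : Hl => (1 : ℝ)) := by
    ext x
    simp [abs, sub_eq_add_neg, add_comm]
  rw [habs, hsup _ _ hsub (hsub.const_smul (-1 : ℝ)), hsmul _ _ hsub, hadd _ _ hf hc,
    hsmul _ _ hone, h1, neg_one_mul, mul_one, ← sub_eq_add_neg]
  rfl

theorem map_const (hφ : IsLatticeHom φ) (h1 : φ (fun _ => (1 : ℝ)) = 1) (c : ℝ) :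
    φ (fun _ => c) = c := by
  have h := hφ.2.1 c (fun _ => 1) uniformContinuous_const
  rwa [h1, mul_one, show (c • fun _ : Hl => (1 : ℝ)) = fun _ => c from
    funext fun _ => mul_one c] at h

end IsLatticeHom

/-- Every unital vector-lattice homomorphism on `U` is an evaluation at a point of the
half-line. -/
theorem unital_hom_is_evaluation (φ : (Hl → ℝ) → ℝ) (hφ : IsLatticeHom φ)
    (h1 : φ (fun _ => (1 : ℝ)) = 1) :
    ∃ t : Hl, ∀ f : Hl → ℝ, UniformContinuous f → φ f = f t := by
  have hX : UniformContinuous (fun x : Hl => (x : ℝ)) := uniformContinuous_subtype_val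
  have ha : 1 ≤ φ (fun x : Hl => (x : ℝ)) :=
    h1.ge.trans (hφ.map_mono uniformContinuous_const hX fun x => x.2)
  refine ⟨⟨φ (fun x : Hl => (x : ℝ)), ha⟩, fun f hf => ?_⟩
  set a : Hl := ⟨φ (fun x : Hl => (x : ℝ)), ha⟩ with ha_def
  by_contra hne
  have hpos : 0 < |f a - φ f| / 2 := half_pos (abs_pos.mpr (sub_ne_zero.mpr (Ne.symm hne)))
  obtain ⟨δ, hδ, hclose⟩ := Metric.continuous_iff.mp hf.continuous a _ hpos
  have hu : UniformContinuous (fun x => |f x - φ f|) :=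
    uniformContinuous_norm.comp (hf.sub uniformContinuous_const)
  have hv : UniformContinuous (fun x : Hl => |(x : ℝ) - a|) :=
    uniformContinuous_norm.comp (hX.sub uniformContinuous_const)
  have hadd := hφ.1 _ _ hu hv
  rw [hφ.map_abs_sub_const h1 hf, hφ.map_abs_sub_const h1 hX, ha_def, sub_self, sub_self,
    abs_zero, add_zero] at hadd
  have hle : (fun _ => min δ (|f a - φ f| / 2)) ≤
      (fun x => |f x - φ f|) + (fun x : Hl => |(x : ℝ) - a|) := by
    intro x
    by_cases hx : dist x a < δ
    · refine (min_le_right _ _).trans (le_add_of_le_of_nonneg ?_ (abs_nonneg _))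
      have h := hclose x hx
      rw [Real.dist_eq, abs_sub_comm] at h
      have := abs_sub_le (f a) (f x) (φ f)
      change |f a - φ f| / 2 ≤ |f x - φ f|
      linarith
    · exact (min_le_left _ _).trans (le_add_of_nonneg_of_le (abs_nonneg _) (not_lt.mp hx))
  have h := hφ.map_mono uniformContinuous_const (hu.add hv) hle
  rw [hφ.map_const h1] at h
  exact absurd (h.trans_eq hadd) (not_le.mpr (lt_min hδ hpos))
end

section
/- Approximation lemma: let φ : U → ℝ be a vector-lattice homomorphism with φ(𝔱) = 1 and φ(𝟏) = 0. Then for any finitely many functions f₁, …, f_k ∈ U and any ε > 0 there exists a positive integer n such that |φ(f_i) − f_i(n)/n| < ε for all 1 ≤ i ≤ k. In particular, φ lies in the closure of the set { n⁻¹·δ_n : n ∈ ℕ } in the topology of pointwise convergence on U, where δ_n(f) = f(n). -/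
open Filter Topology

/-- The point of the half-line corresponding to a positive integer. -/
def toH (n : ℕ+) : Hl := ⟨((n : ℕ) : ℝ), Set.mem_Ici.mpr (by exact_mod_cast n.one_le)⟩

/-- A uniformly continuous function on the half-line varies by a bounded amount over intervals
of length at most one. -/
lemma UniformContinuous.exists_bound_sub_le_one {g : Hl → ℝ} (hg : UniformContinuous g) :
    ∃ C : ℝ, ∀ x y : Hl, x ≤ y → (y : ℝ) - x ≤ 1 → |g x - g y| ≤ C := by
  obtain ⟨δ, hδ, h⟩ := Metric.uniformContinuous_iff.mp hg 1 one_pos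
  have chain : ∀ m : ℕ, ∀ x y : Hl, x ≤ y → (y : ℝ) - x ≤ m * (δ / 2) → |g x - g y| ≤ m := by
    intro m
    induction m with
    | zero =>
      intro x y hxy hd
      have : x = y := le_antisymm hxy (Subtype.coe_le_coe.mp (by simpa using hd))
      simp [this]
    | succ m ih =>
      intro x y hxy hd
      have hxy' : (x : ℝ) ≤ y := hxy
      let z : Hl := ⟨max x (y - δ / 2), Set.mem_Ici.mpr (le_max_of_le_left x.2)⟩
      have hz : (z : ℝ) = max (x : ℝ) (y - δ / 2) := rfl
      push_cast at hd ⊢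
      have hxz : |g x - g z| ≤ m := by
        refine ih x z (le_max_left (x : ℝ) _) ?_
        rw [hz, sub_le_iff_le_add]
        refine max_le ?_ (by linarith)
        have : 0 ≤ (m : ℝ) * (δ / 2) := by positivity
        linarith
      have hzy : |g z - g y| < 1 := by
        refine h (a := z) (b := y) ?_
        have h₁ : (z : ℝ) ≤ y := by rw [hz]; exact max_le hxy' (by linarith)
        have h₂ : (y : ℝ) - δ / 2 ≤ z := le_max_right _ _
        rw [Subtype.dist_eq, Real.dist_eq, abs_lt]
        constructor <;> linarith
      linarith [abs_sub_le (g x) (g z) (g y)]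
  obtain ⟨m, hm⟩ := exists_nat_ge (1 / (δ / 2))
  refine ⟨m, fun x y hxy hd => chain m x y hxy (hd.trans ?_)⟩
  rwa [div_le_iff₀ (by positivity)] at hm

namespace IsLatticeHom

variable {φ : (Hl → ℝ) → ℝ}

lemma mono (hφ : IsLatticeHom φ) {f g : Hl → ℝ} (hf : UniformContinuous f)
    (hg : UniformContinuous g) (hfg : f ≤ g) : φ f ≤ φ g := by
  have h := hφ.2.2 f g hf hg
  rw [sup_eq_right.mpr hfg] at h
  exact h ▸ le_max_left _ _

lemma map_abs (hφ : IsLatticeHom φ) {f : Hl → ℝ} (hf : UniformContinuous f) :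
    φ |f| = |φ f| := by
  have hneg : φ (-f) = -φ f := by simpa using hφ.2.1 (-1) f hf
  rw [abs, hφ.2.2 f (-f) hf hf.neg, hneg, abs_eq_max_neg]

lemma map_zero (hφ : IsLatticeHom φ) : φ 0 = 0 := by
  simpa using hφ.2.1 0 0 uniformContinuous_const

lemma uniformContinuous_sum_and_map_sum (hφ : IsLatticeHom φ) {ι : Type*} (s : Finset ι)
    {f : ι → Hl → ℝ} (hf : ∀ i, UniformContinuous (f i)) :
    UniformContinuous (∑ i ∈ s, f i) ∧ φ (∑ i ∈ s, f i) = ∑ i ∈ s, φ (f i) := by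
  classical
  induction s using Finset.induction_on with
  | empty => exact ⟨uniformContinuous_const, by simp [hφ.map_zero]⟩
  | insert a s ha ih =>
    simp only [Finset.sum_insert ha]
    exact ⟨(hf a).add ih.1, by rw [hφ.1 _ _ (hf a) ih.1, ih.2]⟩

/-- A function in the kernel of a lattice homomorphism that sends the identity to `1` and the
constant `1` to `0` is smaller than `ε n` at some positive integer `n`. -/
lemma exists_lt_mul (hφ : IsLatticeHom φ) (ht : φ (fun t : Hl => (t : ℝ)) = 1)
    (h1 : φ (fun _ => (1 : ℝ)) = 0) {g : Hl → ℝ} (hg : UniformContinuous g) (hg0 : φ g = 0)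
    {ε : ℝ} (hε : 0 < ε) : ∃ n : ℕ+, g (toH n) < ε * (n : ℕ) := by
  by_contra! hlarge
  obtain ⟨C, hC⟩ := hg.exists_bound_sub_le_one
  have hid : UniformContinuous (fun t : Hl => (t : ℝ)) := uniformContinuous_subtype_val
  have hone : UniformContinuous (fun _ : Hl => (1 : ℝ)) := uniformContinuous_const
  have hle : ε • (fun t : Hl => (t : ℝ)) ≤ g + (C + ε) • (fun _ : Hl => (1 : ℝ)) := by
    intro t
    have ht1 : (1 : ℝ) ≤ t := t.2
    let n : ℕ+ := ⟨⌊(t : ℝ)⌋₊, Nat.floor_pos.mpr ht1⟩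
    have hn : (n : ℕ) = ⌊(t : ℝ)⌋₊ := rfl
    have hfloor : ((n : ℕ) : ℝ) ≤ t := by rw [hn]; exact Nat.floor_le (by linarith)
    have hfloor' : (t : ℝ) < (n : ℕ) + 1 := by rw [hn]; exact Nat.lt_floor_add_one _
    have hvar := (abs_le.mp (hC (toH n) t hfloor
      (by change (t : ℝ) - ((n : ℕ) : ℝ) ≤ 1; linarith))).2
    have hmul := mul_le_mul_of_nonneg_left hfloor'.le hε.le
    simp only [Pi.smul_apply, Pi.add_apply, smul_eq_mul, mul_one]
    linarith [hlarge n]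
  have hc : UniformContinuous ((C + ε) • (fun _ : Hl => (1 : ℝ))) := hone.const_smul _
  have h : φ (ε • fun t : Hl => (t : ℝ)) ≤ φ (g + (C + ε) • fun _ : Hl => (1 : ℝ)) :=
    hφ.mono (hid.const_smul ε) (hg.add hc) hle
  rw [hφ.1 _ _ hg hc, hφ.2.1 _ _ hid, hφ.2.1 _ _ hone, ht, h1, hg0] at h
  linarith

end IsLatticeHom

/-- Approximation lemma: if `φ : U → ℝ` is a vector-lattice homomorphism with
`φ(𝔱) = 1` and `φ(𝟏) = 0`, then for finitely many `f₁, …, f_k ∈ U` and `ε > 0` there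
is a positive integer `n` with `|φ(f i) - f i (n) / n| < ε` for all `i`; that is, `φ`
lies in the closure of the normalized evaluations `n⁻¹ δ_n` in the topology of
pointwise convergence on `U`. -/
theorem hom_approximation (φ : (Hl → ℝ) → ℝ) (hφ : IsLatticeHom φ)
    (ht : φ (fun t : Hl => (t : ℝ)) = 1) (h1 : φ (fun _ => (1 : ℝ)) = 0)
    (k : ℕ) (f : Fin k → Hl → ℝ) (hf : ∀ i, UniformContinuous (f i))
    (ε : ℝ) (hε : 0 < ε) :
    ∃ n : ℕ+, ∀ i : Fin k, |φ (f i) - f i (toH n) / ((n : ℕ) : ℝ)| < ε := by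
  have hid : UniformContinuous (fun t : Hl => (t : ℝ)) := uniformContinuous_subtype_val
  let d : Fin k → Hl → ℝ := fun i => f i + (-φ (f i)) • (fun t : Hl => (t : ℝ))
  have hd : ∀ i, UniformContinuous (d i) := fun i => (hf i).add (hid.const_smul _)
  have hd0 : ∀ i, φ (d i) = 0 := fun i => by
    rw [hφ.1 _ _ (hf i) (hid.const_smul _), hφ.2.1 _ _ hid, ht]
    ring
  have hda : ∀ i, UniformContinuous |d i| := fun i => uniformContinuous_norm.comp (hd i)
  obtain ⟨hsum, hφsum⟩ := hφ.uniformContinuous_sum_and_map_sum Finset.univ hda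
  obtain ⟨n, hn⟩ := hφ.exists_lt_mul ht h1 hsum
    (by simp [hφsum, hφ.map_abs (hd _), hd0]) hε
  refine ⟨n, fun i => ?_⟩
  have hpos : (0 : ℝ) < (n : ℕ) := by exact_mod_cast n.pos
  have hterm : |d i (toH n)| < ε * (n : ℕ) := by
    refine lt_of_le_of_lt ?_ hn
    rw [Finset.sum_apply]
    exact Finset.single_le_sum (f := fun j => |d j| (toH n)) (fun j _ => abs_nonneg _)
      (Finset.mem_univ i)
  have hdi : φ (f i) - f i (toH n) / ((n : ℕ) : ℝ) = -d i (toH n) / ((n : ℕ) : ℝ) := by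
    simp only [d, toH, Pi.add_apply, Pi.smul_apply, smul_eq_mul]
    field_simp
    ring
  rwa [hdi, abs_div, abs_neg, abs_of_pos hpos, div_lt_iff₀ hpos]
end

section
/- The normalized evaluations are dense in the fiber H_𝔱: for every vector-lattice homomorphism φ : U → ℝ with φ(𝔱) = 1, every finite family f₁, …, f_k ∈ U and every ε > 0, there exists t ∈ ℍ such that |φ(f_i) − f_i(t)/t| < ε for all 1 ≤ i ≤ k; that is, the set { t⁻¹·δ_t : t ∈ ℍ } is dense in H_𝔱 in the topology of pointwise convergence on U. -/
open Filter Topology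

/-- Finitely many functions annihilated by a lattice homomorphism are jointly dominated in absolute
value by a function annihilated by it. -/
lemma IsLatticeHom.exists_dominating {φ : (Hl → ℝ) → ℝ} (hφ : IsLatticeHom φ) {ι : Type*}
    (s : Finset ι) (h : ι → Hl → ℝ) (hu : ∀ i, UniformContinuous (h i)) (h0 : ∀ i, φ (h i) = 0) :
    ∃ g : Hl → ℝ, UniformContinuous g ∧ φ g = 0 ∧ ∀ i ∈ s, ∀ t, |h i t| ≤ g t := by
  classical
  obtain ⟨-, hsmul, hsup⟩ := hφ
  induction s using Finset.induction_on with
  | empty =>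
    refine ⟨0, uniformContinuous_const, ?_, by simp⟩
    simpa using hsmul 0 0 uniformContinuous_const
  | insert a s _ ih =>
    obtain ⟨g, hg, hg0, hgs⟩ := ih
    have hn : UniformContinuous ((-1 : ℝ) • h a) := (hu a).const_smul _
    have habs : UniformContinuous (h a ⊔ (-1 : ℝ) • h a) :=
      lipschitzWith_max.uniformContinuous.comp ((hu a).prodMk hn)
    refine ⟨(h a ⊔ (-1 : ℝ) • h a) ⊔ g,
      lipschitzWith_max.uniformContinuous.comp (habs.prodMk hg), ?_, fun i hi t => ?_⟩
    · rw [hsup _ _ habs hg, hsup _ _ (hu a) hn, hsmul _ _ (hu a), h0, hg0]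
      simp
    · rcases Finset.mem_insert.mp hi with rfl | hi
      · exact (by simp [abs_le', le_total] : |h i t| ≤ (h i ⊔ (-1 : ℝ) • h i) t).trans le_sup_left
      · exact (hgs i hi t).trans le_sup_right

lemma IsLatticeHom.mono_s14 {φ : (Hl → ℝ) → ℝ} (hφ : IsLatticeHom φ) {f g : Hl → ℝ}
    (hf : UniformContinuous f) (hg : UniformContinuous g) (hfg : f ≤ g) : φ f ≤ φ g := by
  have h := hφ.2.2 f g hf hg
  rw [sup_eq_right.mpr hfg] at h
  exact h ▸ le_max_left _ _

/-- The normalized evaluations `t⁻¹ δ_t`, `t ∈ [1, ∞)`, are dense in the fiber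
`H_𝔱`: if `φ : U → ℝ` is a vector-lattice homomorphism with `φ(𝔱) = 1`, then for any
`f₁, …, f_k ∈ U` and `ε > 0` there is a point `t` of the half-line with
`|φ(f i) - f i (t) / t| < ε` for all `i`. -/
theorem normalized_evaluations_dense (φ : (Hl → ℝ) → ℝ) (hφ : IsLatticeHom φ)
    (ht : φ (fun t : Hl => (t : ℝ)) = 1)
    (k : ℕ) (f : Fin k → Hl → ℝ) (hf : ∀ i, UniformContinuous (f i))
    (ε : ℝ) (hε : 0 < ε) :
    ∃ t : Hl, ∀ i : Fin k, |φ (f i) - f i t / (t : ℝ)| < ε := by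
  have hid : UniformContinuous (fun t : Hl => (t : ℝ)) := uniformContinuous_subtype_val
  have hlin (c : ℝ) : UniformContinuous (c • fun t : Hl => (t : ℝ)) := hid.const_smul c
  obtain ⟨g, hg, hg0, hgf⟩ := hφ.exists_dominating Finset.univ
    (fun i => f i + (-φ (f i)) • fun t : Hl => (t : ℝ)) (fun i => (hf i).add (hlin _))
    (fun i => by rw [hφ.1 _ _ (hf i) (hlin _), hφ.2.1 _ _ hid, ht]; ring)
  by_contra! hcon
  have hle : (ε • fun t : Hl => (t : ℝ)) ≤ g := by
    intro t
    obtain ⟨i, hi⟩ := hcon t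
    have htpos : (0 : ℝ) < t := zero_lt_one.trans_le t.2
    refine le_trans ?_ (hgf i (Finset.mem_univ i) t)
    calc ε * (t : ℝ) ≤ |φ (f i) - f i t / t| * t := by gcongr
      _ = |(φ (f i) - f i t / t) * t| := by rw [abs_mul, abs_of_pos htpos]
      _ = |f i t + -φ (f i) * t| := by
        rw [← abs_neg]
        congr 1
        field_simp
        ring
  have := hφ.mono_s14 (hlin ε) hg hle
  rw [hφ.2.1 _ _ hid, ht, hg0] at this
  linarith
end
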